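/- Let g ≥ 3 and set ℓ := ⌈384 g³ log K⌉. There exist constants c = c(g) > 0 and K_0 = K_0(g) such that for all integers K ≥ K_0, every integer k, and every real θ with w_K((g−1)θ) > ℓ, one has |Σ_{n < g^K, s_g(n) = k} e(nθ)| ≤ c · g^K K^{−12}. -/

import Mathlib

set_option autoImplicit false

noncomputable section

/-- `e(x) = exp(2πix)`. -/
def eC (x : ℝ) : ℂ := Complex.exp (2 * Real.pi * Complex.I * x)

/-- Base-`g` digit sum. -/
def digitSum (g n : ℕ) : ℕ := (Nat.digits g n).sum

/-- `S_g(k)`: naturals below `g^K` with base-`g` digit sum `k`. -/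
def Sset (g K : ℕ) (k : ℤ) : Finset ℕ :=
  (Finset.range (g ^ K)).filter fun n => (digitSum g n : ℤ) = k

/-- Left endpoint of the fundamental interval for the centred base-`g` expansion:
`-1/2` for odd `g` and `-(g-2)/(2(g-1))` for even `g`. -/
def Lg (g : ℕ) : ℝ :=
  if g % 2 = 1 then -(1 / 2) else -(((g : ℝ) - 2) / (2 * ((g : ℝ) - 1)))

/-- The `i`-th digit (`i ≥ 1`) of the centred base-`g` expansion of (the representative
modulo 1 of) `α`, chosen so that ambiguous expansions end in the minimal digit. -/
def centredDigit (g : ℕ) (α : ℝ) (i : ℕ) : ℤ :=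
  ⌊(g : ℝ) ^ i * α - Lg g⌋ - g * ⌊(g : ℝ) ^ (i - 1) * α - Lg g⌋

/-- `w_K(α)`: the number of nonzero digits among the first `K` digits of the centred
base-`g` expansion of `α`. -/
def wK (g K : ℕ) (α : ℝ) : ℕ :=
  ((Finset.Icc 1 K).filter fun i => centredDigit g α i ≠ 0).card

theorem eC_add (x y : ℝ) : eC (x + y) = eC x * eC y := by
  simp only [eC, ← Complex.exp_add]
  congr 1
  push_cast
  ring

theorem norm_eC (x : ℝ) : ‖eC x‖ = 1 := by
  rw [eC, show 2 * (Real.pi : ℂ) * Complex.I * x = ((2 * Real.pi * x : ℝ) : ℂ) * Complex.I by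
    push_cast; ring, Complex.norm_exp_ofReal_mul_I]

theorem continuous_eC : Continuous eC := by
  unfold eC
  fun_prop

theorem integral_eC_intCast_mul (m : ℤ) :
    ∫ β in (0 : ℝ)..1, eC ((m : ℝ) * β) = if m = 0 then 1 else 0 := by
  split_ifs with h
  · simp [h, eC]
  · have hc : 2 * (Real.pi : ℂ) * Complex.I * m ≠ 0 := by
      simp [Real.pi_ne_zero, h]
    have h1 : ∀ β : ℝ, eC ((m : ℝ) * β) = Complex.exp (2 * Real.pi * Complex.I * m * β) := by
      intro β
      rw [eC]
      push_cast
      ring_nf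
    simp only [h1]
    rw [integral_exp_mul_complex hc]
    have h2 : Complex.exp (2 * Real.pi * Complex.I * m) = 1 :=
      Complex.exp_eq_one_iff.mpr ⟨m, by ring⟩
    simp [h2]

theorem sum_range_mul_eq {M : Type*} [AddCommMonoid M] (g N : ℕ) (f : ℕ → M) :
    ∑ n ∈ Finset.range (g * N), f n =
      ∑ m ∈ Finset.range N, ∑ d ∈ Finset.range g, f (g * m + d) := by
  induction N with
  | zero => simp
  | succ N ih => rw [Nat.mul_succ, Finset.sum_range_add, ih, Finset.sum_range_succ]

theorem digitSum_mul_add {g : ℕ} (hg : 1 < g) (m d : ℕ) (hd : d < g) :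
    digitSum g (g * m + d) = d + digitSum g m := by
  unfold digitSum
  by_cases h : d ≠ 0 ∨ m ≠ 0
  · rw [add_comm (g * m) d, Nat.digits_add g hg d m hd h, List.sum_cons]
  · push Not at h
    simp [h.1, h.2]

/-- The exponential sum over a single digit. -/
def digitExpSum (g : ℕ) (x : ℝ) : ℂ := ∑ d ∈ Finset.range g, eC ((d : ℝ) * x)

theorem sum_eC_digitSum_eq_prod {g : ℕ} (hg : 1 < g) (K : ℕ) (θ β : ℝ) :
    ∑ n ∈ Finset.range (g ^ K), eC ((n : ℝ) * θ + (digitSum g n : ℝ) * β) =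
      ∏ i ∈ Finset.range K, digitExpSum g ((g : ℝ) ^ i * θ + β) := by
  induction K generalizing θ with
  | zero => simp [digitSum, eC]
  | succ K ih =>
    rw [pow_succ', sum_range_mul_eq, Finset.prod_range_succ']
    have h : ∀ i ∈ Finset.range K, digitExpSum g ((g : ℝ) ^ (i + 1) * θ + β) =
        digitExpSum g ((g : ℝ) ^ i * (g * θ) + β) := by
      intro i _
      rw [pow_succ, mul_assoc]
    rw [Finset.prod_congr rfl h, ← ih, digitExpSum, Finset.sum_mul_sum]
    refine Finset.sum_congr rfl fun m _ => Finset.sum_congr rfl fun d hd => ?_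
    rw [digitSum_mul_add hg m d (Finset.mem_range.mp hd), ← eC_add]
    congr 1
    push_cast
    ring

theorem norm_one_add_eC_le (x : ℝ) : ‖1 + eC x‖ ≤ 2 - 4 * (x - round x) ^ 2 := by
  set y := x - round x with hy
  have hyx : |y| ≤ 1 / 2 := abs_sub_round x
  have hsq : y ^ 2 ≤ 1 / 4 := by
    rw [← sq_abs]
    nlinarith [abs_nonneg y]
  have hper : eC x = Complex.exp ((2 * Real.pi * y : ℝ) * Complex.I) := by
    rw [eC, Complex.exp_eq_exp_iff_exists_int]
    exact ⟨round x, by rw [hy]; push_cast; ring⟩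
  have hcos : Real.cos (2 * Real.pi * y) ≤ 1 - 8 * y ^ 2 := by
    have h := Real.mul_abs_le_abs_sin (x := Real.pi * y) (by
      rw [abs_mul, abs_of_pos Real.pi_pos]
      nlinarith [Real.pi_pos])
    rw [abs_mul, abs_of_pos Real.pi_pos, ← mul_assoc, div_mul_cancel₀ _ Real.pi_ne_zero,
      ← abs_of_pos (two_pos : (0 : ℝ) < 2), ← abs_mul] at h
    rw [mul_assoc, Real.cos_two_mul, Real.cos_sq']
    nlinarith [sq_le_sq.mpr h]
  have hnorm : ‖1 + eC x‖ ^ 2 = 2 + 2 * Real.cos (2 * Real.pi * y) := by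
    rw [hper, Complex.exp_mul_I, ← Complex.normSq_eq_norm_sq, ← Complex.ofReal_cos,
      ← Complex.ofReal_sin, Complex.normSq_apply]
    simp only [Complex.add_re, Complex.add_im, Complex.one_re, Complex.one_im, Complex.mul_re,
      Complex.mul_im, Complex.ofReal_re, Complex.ofReal_im, Complex.I_re, Complex.I_im]
    nlinarith [Real.sin_sq_add_cos_sq (2 * Real.pi * y)]
  apply le_of_sq_le_sq _ (by linarith)
  nlinarith [sq_nonneg (y ^ 2)]

theorem norm_digitExpSum_le {g : ℕ} (hg : 2 ≤ g) (x : ℝ) :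
    ‖digitExpSum g x‖ ≤ g * Real.exp (-(4 / g) * (x - round x) ^ 2) := by
  obtain ⟨h, rfl⟩ := Nat.exists_eq_add_of_le hg
  have hpos : (0 : ℝ) < ((2 + h : ℕ) : ℝ) := by positivity
  have h1 : ‖digitExpSum (2 + h) x‖ ≤ (2 - 4 * (x - round x) ^ 2) + h := by
    rw [digitExpSum, Finset.sum_range_add]
    refine (norm_add_le _ _).trans (add_le_add ?_ ?_)
    · simpa [Finset.sum_range_succ, eC] using norm_one_add_eC_le x
    · refine (norm_sum_le _ _).trans ?_
      simp [norm_eC]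
  have h2 := Real.add_one_le_exp (-(4 / ((2 + h : ℕ) : ℝ)) * (x - round x) ^ 2)
  refine h1.trans (le_trans (le_of_eq ?_) (mul_le_mul_of_nonneg_left h2 hpos.le))
  field_simp
  push_cast
  ring

theorem sq_sub_round_sub_le (x y : ℝ) :
    ((y - x) - round (y - x)) ^ 2 ≤ 2 * ((x - round x) ^ 2 + (y - round y) ^ 2) := by
  have h := round_le (y - x) (round y - round x)
  have h' := sq_le_sq.mpr h
  push_cast at h'
  nlinarith [sq_nonneg ((y - round y) + (x - round x))]

theorem neg_Lg_mem_Icc {g : ℕ} (hg : 3 ≤ g) : -Lg g ∈ Set.Icc (1 / 3 : ℝ) (1 / 2) := by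
  unfold Lg
  split_ifs with h
  · norm_num
  · have h4 : (4 : ℝ) ≤ g := by
      exact_mod_cast (show 4 ≤ g by omega)
    rw [neg_neg]
    constructor
    · rw [div_le_div_iff₀ (by norm_num) (by linarith)]
      linarith
    · rw [div_le_div_iff₀ (by linarith) (by norm_num)]
      linarith

theorem le_abs_sub_round_of_centredDigit_ne_zero {g : ℕ} (hg : 3 ≤ g) (α : ℝ) (i : ℕ)
    (h : centredDigit g α (i + 1) ≠ 0) :
    1 / (4 * (g : ℝ)) ≤ |(g : ℝ) ^ i * α - round ((g : ℝ) ^ i * α)| := by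
  contrapose! h
  obtain ⟨hL1, hL2⟩ := neg_Lg_mem_Icc hg
  have hg' : (3 : ℝ) ≤ g := by exact_mod_cast hg
  set y := (g : ℝ) ^ i * α with hy
  set r := round y with hr
  have hgy : (g : ℝ) ^ (i + 1) * α = g * y := by rw [hy]; ring
  rw [lt_div_iff₀ (by linarith)] at h
  obtain ⟨h1, h2⟩ := abs_lt.mp (show |g * (y - r)| < 1 / 4 by
    rw [abs_mul, abs_of_pos (by linarith : (0 : ℝ) < g)]
    linarith)
  have hδ1 : -(1 / 12) < y - r := by nlinarith
  have hδ2 : y - r < 1 / 12 := by nlinarith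
  have e1 : ⌊y - Lg g⌋ = r := by
    rw [Int.floor_eq_iff]
    constructor <;> linarith
  have e2 : ⌊g * y - Lg g⌋ = g * r := by
    rw [Int.floor_eq_iff]
    push_cast
    constructor <;> linarith
  rw [centredDigit, hgy, Nat.add_sub_cancel, ← hy, e1, e2, sub_self]

theorem wK_succ_le {g : ℕ} (hg : 3 ≤ g) (m : ℕ) (α : ℝ) :
    ((wK g (m + 1) α : ℝ) - 1) / (16 * (g : ℝ) ^ 2) ≤
      ∑ j ∈ Finset.range m, ((g : ℝ) ^ j * α - round ((g : ℝ) ^ j * α)) ^ 2 := by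
  have hg' : (0 : ℝ) < g := by exact_mod_cast (by omega : 0 < g)
  set p : ℕ → Prop := fun j => centredDigit g α (j + 1) ≠ 0
  have hw : wK g (m + 1) α ≤ ((Finset.range m).filter p).card + 1 := by
    have hsub : (Finset.Icc 1 (m + 1)).filter (fun i => centredDigit g α i ≠ 0) ⊆
        insert (m + 1) (((Finset.range m).filter p).image (· + 1)) := by
      intro i hi
      simp only [Finset.mem_filter, Finset.mem_Icc] at hi
      obtain ⟨⟨hi1, hi2⟩, hi3⟩ := hi
      obtain ⟨j, rfl⟩ := Nat.exists_eq_add_of_le' hi1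
      rcases Nat.lt_or_ge j m with hj | hj
      · exact Finset.mem_insert_of_mem (Finset.mem_image_of_mem _
          (Finset.mem_filter.mpr ⟨Finset.mem_range.mpr hj, hi3⟩))
      · rw [show j = m by omega]
        exact Finset.mem_insert_self _ _
    exact (Finset.card_le_card hsub).trans ((Finset.card_insert_le _ _).trans
      (Nat.add_le_add_right Finset.card_image_le 1))
  have hw' : (wK g (m + 1) α : ℝ) - 1 ≤ ((Finset.range m).filter p).card := by
    rw [sub_le_iff_le_add]
    exact_mod_cast hw
  calc ((wK g (m + 1) α : ℝ) - 1) / (16 * (g : ℝ) ^ 2)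
      ≤ ((Finset.range m).filter p).card / (16 * (g : ℝ) ^ 2) := by gcongr
    _ = ∑ j ∈ (Finset.range m).filter p, (1 / (4 * (g : ℝ))) ^ 2 := by
        rw [Finset.sum_const, nsmul_eq_mul]
        field_simp
        norm_num
    _ ≤ ∑ j ∈ (Finset.range m).filter p,
          ((g : ℝ) ^ j * α - round ((g : ℝ) ^ j * α)) ^ 2 := by
        refine Finset.sum_le_sum fun j hj => ?_
        have h := le_abs_sub_round_of_centredDigit_ne_zero hg α j (Finset.mem_filter.mp hj).2
        rw [← sq_abs ((g : ℝ) ^ j * α - _)]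
        gcongr
    _ ≤ _ := Finset.sum_le_sum_of_subset_of_nonneg (Finset.filter_subset _ _)
        fun _ _ _ => sq_nonneg _

theorem sum_sq_sub_round_le (g m : ℕ) (θ β : ℝ) :
    ∑ j ∈ Finset.range m,
        ((g : ℝ) ^ j * (((g : ℝ) - 1) * θ) - round ((g : ℝ) ^ j * (((g : ℝ) - 1) * θ))) ^ 2 ≤
      4 * ∑ i ∈ Finset.range (m + 1),
        (((g : ℝ) ^ i * θ + β) - round ((g : ℝ) ^ i * θ + β)) ^ 2 := by
  set u : ℕ → ℝ := fun i => (((g : ℝ) ^ i * θ + β) - round ((g : ℝ) ^ i * θ + β)) ^ 2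
  have h : ∀ j ∈ Finset.range m,
      ((g : ℝ) ^ j * (((g : ℝ) - 1) * θ) - round ((g : ℝ) ^ j * (((g : ℝ) - 1) * θ))) ^ 2 ≤
        2 * (u j + u (j + 1)) := by
    intro j _
    have := sq_sub_round_sub_le ((g : ℝ) ^ j * θ + β) ((g : ℝ) ^ (j + 1) * θ + β)
    rwa [show (g : ℝ) ^ (j + 1) * θ + β - ((g : ℝ) ^ j * θ + β) =
      (g : ℝ) ^ j * (((g : ℝ) - 1) * θ) by ring] at this
  refine (Finset.sum_le_sum h).trans ?_
  rw [← Finset.mul_sum, Finset.sum_add_distrib]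
  have h1 := Finset.sum_range_succ u m
  have h2 := Finset.sum_range_succ' u m
  have h3 : 0 ≤ u m := sq_nonneg _
  have h4 : 0 ≤ u 0 := sq_nonneg _
  linarith

theorem norm_prod_digitExpSum_le {g : ℕ} (hg : 3 ≤ g) (m : ℕ) (θ β : ℝ) :
    ‖∏ i ∈ Finset.range (m + 1), digitExpSum g ((g : ℝ) ^ i * θ + β)‖ ≤
      (g : ℝ) ^ (m + 1) *
        Real.exp (-(((wK g (m + 1) (((g : ℝ) - 1) * θ) : ℝ) - 1) / (16 * (g : ℝ) ^ 3))) := by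
  have hg' : (0 : ℝ) < g := by exact_mod_cast (by omega : 0 < g)
  rw [norm_prod]
  refine (Finset.prod_le_prod (fun _ _ => norm_nonneg _)
    fun i _ => norm_digitExpSum_le (by omega : 2 ≤ g) _).trans ?_
  rw [Finset.prod_mul_distrib, Finset.prod_const, Finset.card_range, ← Real.exp_sum,
    ← Finset.mul_sum]
  refine mul_le_mul_of_nonneg_left (Real.exp_le_exp.mpr ?_) (by positivity)
  have h := (wK_succ_le hg m (((g : ℝ) - 1) * θ)).trans (sum_sq_sub_round_le g m θ β)
  have h' := mul_le_mul_of_nonneg_left h (inv_nonneg.mpr hg'.le)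
  rw [neg_mul, neg_le_neg_iff]
  refine le_trans (le_of_eq ?_) (h'.trans (le_of_eq ?_))
  · field_simp
  · ring

theorem sum_Sset_eq_integral {g : ℕ} (hg : 1 < g) (K : ℕ) (k : ℤ) (θ : ℝ) :
    ∑ n ∈ Sset g K k, eC ((n : ℝ) * θ) =
      ∫ β in (0 : ℝ)..1, eC (-(k : ℝ) * β) *
        ∏ i ∈ Finset.range K, digitExpSum g ((g : ℝ) ^ i * θ + β) := by
  have h : ∀ β : ℝ, eC (-(k : ℝ) * β) *
      ∏ i ∈ Finset.range K, digitExpSum g ((g : ℝ) ^ i * θ + β) =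
      ∑ n ∈ Finset.range (g ^ K),
        eC ((n : ℝ) * θ) * eC ((((digitSum g n : ℤ) - k : ℤ) : ℝ) * β) := by
    intro β
    rw [← sum_eC_digitSum_eq_prod hg, Finset.mul_sum]
    refine Finset.sum_congr rfl fun n _ => ?_
    rw [← eC_add, ← eC_add]
    congr 1
    push_cast
    ring
  simp only [h]
  rw [intervalIntegral.integral_finsetSum, Sset, Finset.sum_filter]
  swap
  · intro n _
    exact Continuous.intervalIntegrable
      (continuous_const.mul (continuous_eC.comp (continuous_const_mul _))) 0 1
  refine Finset.sum_congr rfl fun n _ => ?_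
  rw [intervalIntegral.integral_const_mul, integral_eC_intCast_mul]
  simp only [sub_eq_zero, mul_ite, mul_one, mul_zero]

theorem statement5 (g : ℕ) (hg : 3 ≤ g) :
    ∃ c : ℝ, 0 < c ∧ ∃ K0 : ℕ, ∀ K : ℕ, K0 ≤ K →
      ∀ k : ℤ, ∀ θ : ℝ,
        (⌈(384 : ℝ) * (g : ℝ) ^ 3 * Real.log K⌉ : ℤ) < (wK g K (((g : ℝ) - 1) * θ) : ℤ) →
        ‖∑ n ∈ Sset g K k, eC ((n : ℝ) * θ)‖ ≤ c * (g : ℝ) ^ K * (K : ℝ) ^ (-(12 : ℝ)) := by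
  refine ⟨1, one_pos, 1, fun K hK k θ hw => ?_⟩
  obtain ⟨m, rfl⟩ := Nat.exists_eq_add_of_le' hK
  have hg' : (0 : ℝ) < g := by exact_mod_cast (by omega : 0 < g)
  have hlog : 0 ≤ Real.log ((m + 1 : ℕ) : ℝ) := Real.log_natCast_nonneg _
  have hw' : (384 : ℝ) * (g : ℝ) ^ 3 * Real.log ((m + 1 : ℕ) : ℝ) ≤
      (wK g (m + 1) (((g : ℝ) - 1) * θ) : ℝ) - 1 := by
    refine (Int.le_ceil _).trans ?_
    exact_mod_cast Int.le_sub_one_of_lt hw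
  have hexp : Real.exp (-(((wK g (m + 1) (((g : ℝ) - 1) * θ) : ℝ) - 1) / (16 * (g : ℝ) ^ 3))) ≤
      ((m + 1 : ℕ) : ℝ) ^ (-(12 : ℝ)) := by
    rw [Real.rpow_def_of_pos (by positivity)]
    refine Real.exp_le_exp.mpr ?_
    rw [mul_neg, neg_le_neg_iff, le_div_iff₀ (by positivity)]
    refine le_trans ?_ hw'
    have : 0 ≤ (g : ℝ) ^ 3 * Real.log ((m + 1 : ℕ) : ℝ) := by positivity
    linarith
  rw [sum_Sset_eq_integral (by omega)]
  refine (intervalIntegral.norm_integral_le_of_norm_le_const fun β _ => ?_).trans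
    (b := 1 * (g : ℝ) ^ (m + 1) * ((m + 1 : ℕ) : ℝ) ^ (-(12 : ℝ)) * |(1 : ℝ) - 0|) (by simp)
  rw [norm_mul, norm_eC, one_mul, one_mul]
  exact (norm_prod_digitExpSum_le hg m θ β).trans
    (mul_le_mul_of_nonneg_left hexp (by positivity))
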